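/- Let ℓ, ℓ' be geodesic lines of ℍ and g, g' ∈ PSL(2,ℝ). The left AdS crooked planes g·C(ℓ) = {g h : h ∈ C(ℓ)} and g'·C(ℓ') are disjoint subsets of PSL(2,ℝ) if and only if there exists K > 0 such that d(g·x, g'·x') ≥ d(x, x') + K for all x ∈ ℓ and x' ∈ ℓ'. -/

import Mathlib

noncomputable section

open Filter Topology Pointwise
open scoped UpperHalfPlane

/-- `SL(2,ℝ)`. -/
abbrev SL2 := Matrix.SpecialLinearGroup (Fin 2) ℝ

instance : TopologicalSpace SL2 :=
  TopologicalSpace.induced (fun A : SL2 => (A : Matrix (Fin 2) (Fin 2) ℝ)) inferInstance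

/-- `PSL(2,ℝ) = SL(2,ℝ)/{±I}`. -/
abbrev PSL2 := SL2 ⧸ Subgroup.center SL2

/-- The Möbius action of an element of `PSL(2,ℝ)` on the upper half-plane,
computed via an (arbitrary) lift to `SL(2,ℝ)`; this is well defined since
`-I` acts trivially. -/
def pslSMul (g : PSL2) (z : ℍ) : ℍ := (Quotient.out g) • z

/-- Image of a subset of `ℍ` under the Möbius action of `g ∈ PSL(2,ℝ)`. -/
def pslImg (g : PSL2) (s : Set ℍ) : Set ℍ := pslSMul g '' s

/-- A geodesic line of `ℍ`: the image of an isometric embedding of `ℝ` into `ℍ`. -/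
def IsGeodesicLine (l : Set ℍ) : Prop := ∃ γ : ℝ → ℍ, Isometry γ ∧ Set.range γ = l

/-- The embedding of `ℍ` into the one-point compactification of `ℂ`. -/
def embH (z : ℍ) : OnePoint ℂ := ((z : ℂ) : OnePoint ℂ)

/-- The embedding of `∂∞ℍ = ℝ ∪ {∞}` into the one-point compactification of `ℂ`. -/
def toC : OnePoint ℝ → OnePoint ℂ := OnePoint.map Complex.ofReal

/-- The vector `v(ξ) ∈ ℝ²` associated with a boundary point `ξ ∈ ℝ ∪ {∞}`:
`v(ξ) = (ξ, 1)` for `ξ ∈ ℝ` and `v(∞) = (1, 0)`. -/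
def bvec (ξ : OnePoint ℝ) : Fin 2 → ℝ := Option.elim ξ ![1, 0] (fun r => ![r, 1])

/-- The extended Möbius action of `PSL(2,ℝ)` on `∂∞ℍ = ℝ ∪ {∞}`. -/
def bdSMul (g : PSL2) (ξ : OnePoint ℝ) : OnePoint ℝ :=
  let w := ((Quotient.out g : SL2) : Matrix (Fin 2) (Fin 2) ℝ).mulVec (bvec ξ)
  if w 1 = 0 then OnePoint.infty else ((w 0 / w 1 : ℝ) : OnePoint ℝ)

/-- `ξ ∈ ℝ ∪ {∞}` is an endpoint of the geodesic line `l`: some isometric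
parametrization of `l` tends to `ξ` (in the one-point compactification of `ℂ`). -/
def IsEndpoint (l : Set ℍ) (ξ : OnePoint ℝ) : Prop :=
  ∃ γ : ℝ → ℍ, Isometry γ ∧ Set.range γ = l ∧
    Tendsto (fun t => embH (γ t)) atTop (𝓝 (toC ξ))

/-- `h ∈ PSL(2,ℝ)` has a nonattracting fixed point at `ξ ∈ ℝ ∪ {∞}`. -/
def HasNonattracting (h : PSL2) (ξ : OnePoint ℝ) : Prop :=
  ∃ A : SL2, (QuotientGroup.mk A : PSL2) = h ∧
    ∃ μ : ℝ, |μ| ≤ 1 ∧ (A : Matrix (Fin 2) (Fin 2) ℝ).mulVec (bvec ξ) = μ • bvec ξ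

/-- `h ∈ PSL(2,ℝ)` has a nonrepelling fixed point at `ξ ∈ ℝ ∪ {∞}`. -/
def HasNonrepelling (h : PSL2) (ξ : OnePoint ℝ) : Prop :=
  ∃ A : SL2, (QuotientGroup.mk A : PSL2) = h ∧
    ∃ μ : ℝ, 1 ≤ |μ| ∧ (A : Matrix (Fin 2) (Fin 2) ℝ).mulVec (bvec ξ) = μ • bvec ξ

/-- The right AdS crooked plane `C*(l)` centered at the identity. -/
def rightCrooked (l : Set ℍ) : Set PSL2 :=
  {h | (∃ x ∈ l, pslSMul h x = x) ∨ ∃ ξ, IsEndpoint l ξ ∧ HasNonattracting h ξ}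

/-- The left AdS crooked plane `C(l)` centered at the identity. -/
def leftCrooked (l : Set ℍ) : Set PSL2 :=
  {h | (∃ x ∈ l, pslSMul h x = x) ∨ ∃ ξ, IsEndpoint l ξ ∧ HasNonrepelling h ξ}

/-- A general right AdS crooked plane: a set of the form `g·C*(l)`. -/
def IsRightCrookedPlane (S : Set PSL2) : Prop :=
  ∃ (g : PSL2) (l : Set ℍ), IsGeodesicLine l ∧ S = (g * ·) '' rightCrooked l

/-- A general left AdS crooked plane: a set of the form `C(l)·g`. -/
def IsLeftCrookedPlane (S : Set PSL2) : Prop :=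
  ∃ (g : PSL2) (l : Set ℍ), IsGeodesicLine l ∧ S = (· * g) '' leftCrooked l

variable {Γ : Type*} [Group Γ]

/-- The action `γ·x = ρ(γ) x j(γ)⁻¹` of `Γ` on `PSL(2,ℝ)`, applied to a set. -/
def actImg (j ρ : Γ →* PSL2) (γ : Γ) (S : Set PSL2) : Set PSL2 :=
  (fun x => ρ γ * x * (j γ)⁻¹) '' S

/-- The action `γ·x = ρ(γ) x j(γ)⁻¹` is properly discontinuous. -/
def ProperlyDisc (j ρ : Γ →* PSL2) : Prop :=
  ∀ K : Set PSL2, IsCompact K → {γ : Γ | (actImg j ρ γ K ∩ K).Nonempty}.Finite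

/-- `R` is a fundamental domain for the action `γ·x = ρ(γ) x j(γ)⁻¹`:
`R` is closed, its translates cover `PSL(2,ℝ)`, and the interiors of the
translates are pairwise disjoint. -/
def IsFundDom (j ρ : Γ →* PSL2) (R : Set PSL2) : Prop :=
  IsClosed R ∧ (⋃ γ : Γ, actImg j ρ γ R) = Set.univ ∧
    Pairwise fun γ₁ γ₂ : Γ =>
      Disjoint (interior (actImg j ρ γ₁ R)) (interior (actImg j ρ γ₂ R))

/-- The action admits a fundamental domain bounded by pairwise disjoint
right AdS crooked planes. -/
def AdmitsRightCrookedFD (j ρ : Γ →* PSL2) : Prop :=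
  ∃ (m : ℕ) (D : Fin m → Set PSL2), (∀ i, IsRightCrookedPlane (D i)) ∧
    (∀ (γ γ' : Γ) (i i' : Fin m),
      actImg j ρ γ (D i) = actImg j ρ γ' (D i') ∨
      Disjoint (actImg j ρ γ (D i)) (actImg j ρ γ' (D i'))) ∧
    ∃ x ∈ (⋃ (γ : Γ) (i : Fin m), actImg j ρ γ (D i))ᶜ,
      IsFundDom j ρ
        (closure (connectedComponentIn (⋃ (γ : Γ) (i : Fin m), actImg j ρ γ (D i))ᶜ x))

/-- The action admits a fundamental domain bounded by pairwise disjoint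
left AdS crooked planes. -/
def AdmitsLeftCrookedFD (j ρ : Γ →* PSL2) : Prop :=
  ∃ (m : ℕ) (D : Fin m → Set PSL2), (∀ i, IsLeftCrookedPlane (D i)) ∧
    (∀ (γ γ' : Γ) (i i' : Fin m),
      actImg j ρ γ (D i) = actImg j ρ γ' (D i') ∨
      Disjoint (actImg j ρ γ (D i)) (actImg j ρ γ' (D i'))) ∧
    ∃ x ∈ (⋃ (γ : Γ) (i : Fin m), actImg j ρ γ (D i))ᶜ,
      IsFundDom j ρ
        (closure (connectedComponentIn (⋃ (γ : Γ) (i : Fin m), actImg j ρ γ (D i))ᶜ x))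

/-- The translation length `λ(g) = inf_{p ∈ ℍ} d(p, g·p)`. -/
def transLength (g : PSL2) : ℝ := ⨅ p : ℍ, dist p (pslSMul g p)

/-- `U` is a connected component of `S`. -/
def IsCC (S U : Set ℍ) : Prop := ∃ x ∈ S, connectedComponentIn S x = U

/-- `ξ ∈ ℝ ∪ {∞}` is an ideal point of `U ⊆ ℍ`: a limit of a sequence of points
of `U` in the one-point compactification of `ℂ`. -/
def IsIdealPoint (U : Set ℍ) (ξ : OnePoint ℝ) : Prop :=
  ∃ u : ℕ → ℍ, (∀ n, u n ∈ U) ∧ Tendsto (fun n => embH (u n)) atTop (𝓝 (toC ξ))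

/-- The closed right crooked half-space `H̄*₊(l, U)`. -/
def closedRHS (l U : Set ℍ) : Set PSL2 :=
  {h | (∃ x ∈ l ∪ U, pslSMul h x = x) ∨ ∃ ξ, IsIdealPoint U ξ ∧ HasNonattracting h ξ}

/-- The open right crooked half-space `H*₊(l, U)`. -/
def openRHS (l U : Set ℍ) : Set PSL2 :=
  {h | h ≠ 1 ∧ ((∃ x ∈ U, pslSMul h x = x) ∨
    ∃ ξ, IsIdealPoint U ξ ∧ ¬ IsEndpoint l ξ ∧ HasNonattracting h ξ)}

/-- The circle of (Euclidean) radius `c` in `ℍ` centered at `0`; for suitable `c`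
this is a geodesic line of `ℍ`. -/
def circ (c : ℝ) : Set ℍ := {z : ℍ | ‖(z : ℂ)‖ = c}

/-- The stem quadrant `SQ(ℓ)` for `ℓ = {|z| = 1/R}` transversely oriented towards `0`. -/
def SQell (R : ℝ) : Set PSL2 :=
  {h | ∃ (A : SL2) (α β v : ℝ), (QuotientGroup.mk A : PSL2) = h ∧
    (A : Matrix (Fin 2) (Fin 2) ℝ) = !![α, -v/R; v*R, β] ∧
    |α| < |β| ∧ 2*|v| < |α - β|}

/-- The inverse stem quadrant `SQ(ℓ')⁻¹` for `ℓ' = {|z| = R}` transversely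
oriented towards `∞`. -/
def SQell'inv (R : ℝ) : Set PSL2 :=
  {h | ∃ (A : SL2) (α β v : ℝ), (QuotientGroup.mk A : PSL2) = h ∧
    (A : Matrix (Fin 2) (Fin 2) ℝ) = !![α, v*R; -v/R, β] ∧
    |α| < |β| ∧ 2*|v| < |α - β|}

/-- The stem quadrant `SQ(ℓ')`. -/
def SQell' (R : ℝ) : Set PSL2 := {h | h⁻¹ ∈ SQell'inv R}



/-- The left crooked plane of the imaginary axis, as a subset of `SL(2,ℝ)`. -/
def C0 (H : SL2) : Prop :=
  (∃ s : ℝ, 0 < s ∧ H 0 0 = H 1 1 ∧ H 0 1 = -s^2 * H 1 0) ∨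
  (H 1 0 = 0 ∧ 1 ≤ |H 0 0|) ∨ (H 0 1 = 0 ∧ 1 ≤ |H 1 1|)

/-- Intersection of the two crooked planes in normalized form. -/
def Meet (M N : SL2) : Prop := ∃ H H' : SL2, C0 H ∧ C0 H' ∧ H * M = N * H'

lemma sl_det (A : SL2) : A 0 0 * A 1 1 - A 0 1 * A 1 0 = 1 := by
  have := A.2
  rwa [Matrix.det_fin_two] at this

lemma sl_eq_iff (A B : SL2) : A = B ↔ A 0 0 = B 0 0 ∧ A 0 1 = B 0 1 ∧ A 1 0 = B 1 0 ∧
    A 1 1 = B 1 1 := by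
  constructor
  · rintro rfl; simp
  · rintro ⟨h1, h2, h3, h4⟩
    ext i j
    fin_cases i <;> fin_cases j <;> assumption

lemma mul00 (A B : SL2) : (A * B) 0 0 = A 0 0 * B 0 0 + A 0 1 * B 1 0 := by
  simp [Matrix.SpecialLinearGroup.coe_mul, Matrix.mul_apply, Fin.sum_univ_two]
lemma mul01 (A B : SL2) : (A * B) 0 1 = A 0 0 * B 0 1 + A 0 1 * B 1 1 := by
  simp [Matrix.SpecialLinearGroup.coe_mul, Matrix.mul_apply, Fin.sum_univ_two]
lemma mul10 (A B : SL2) : (A * B) 1 0 = A 1 0 * B 0 0 + A 1 1 * B 1 0 := by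
  simp [Matrix.SpecialLinearGroup.coe_mul, Matrix.mul_apply, Fin.sum_univ_two]
lemma mul11 (A B : SL2) : (A * B) 1 1 = A 1 0 * B 0 1 + A 1 1 * B 1 1 := by
  simp [Matrix.SpecialLinearGroup.coe_mul, Matrix.mul_apply, Fin.sum_univ_two]

/-- Build an element of `SL(2,ℝ)`. -/
def mkSL (a b c d : ℝ) (h : a * d - b * c = 1) : SL2 :=
  ⟨!![a, b; c, d], by rw [Matrix.det_fin_two]; simpa using h⟩

@[simp] lemma mkSL00 (a b c d : ℝ) (h) : (mkSL a b c d h) 0 0 = a := rfl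
@[simp] lemma mkSL01 (a b c d : ℝ) (h) : (mkSL a b c d h) 0 1 = b := rfl
@[simp] lemma mkSL10 (a b c d : ℝ) (h) : (mkSL a b c d h) 1 0 = c := rfl
@[simp] lemma mkSL11 (a b c d : ℝ) (h) : (mkSL a b c d h) 1 1 = d := rfl

/-- The half-turn exchanging the endpoints of the imaginary axis. -/
def JJ : SL2 := mkSL 0 (-1) 1 0 (by norm_num)

/-- The inverse of `JJ`. -/
def JI : SL2 := mkSL 0 1 (-1) 0 (by norm_num)

lemma JI_mul_JJ : JI * JJ = 1 := by
  rw [sl_eq_iff, mul00, mul01, mul10, mul11]; simp [JJ, JI]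

lemma JJ_mul_JI : JJ * JI = 1 := by
  rw [sl_eq_iff, mul00, mul01, mul10, mul11]; simp [JJ, JI]

lemma C0_conj (H : SL2) (h : C0 H) : C0 (JI * H * JJ) := by
  unfold C0 at *
  simp only [mul00, mul01, mul10, mul11, JJ, JI, mkSL00, mkSL01, mkSL10, mkSL11]
  rcases h with ⟨s, hs, h1, h2⟩ | ⟨h1, h2⟩ | ⟨h1, h2⟩
  · refine Or.inl ⟨s⁻¹, inv_pos.2 hs, by linarith, ?_⟩
    rw [h2]; field_simp; ring
  · refine Or.inr (Or.inr ⟨by rw [h1]; ring, ?_⟩)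
    convert h2 using 2; ring
  · refine Or.inr (Or.inl ⟨by rw [h1]; ring, ?_⟩)
    convert h2 using 2; ring

lemma C0_conj' (H : SL2) (h : C0 H) : C0 (JJ * H * JI) := by
  unfold C0 at *
  simp only [mul00, mul01, mul10, mul11, JJ, JI, mkSL00, mkSL01, mkSL10, mkSL11]
  rcases h with ⟨s, hs, h1, h2⟩ | ⟨h1, h2⟩ | ⟨h1, h2⟩
  · refine Or.inl ⟨s⁻¹, inv_pos.2 hs, by linarith, ?_⟩
    rw [h2]; field_simp; ring
  · refine Or.inr (Or.inr ⟨by rw [h1]; ring, ?_⟩)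
    convert h2 using 2; ring
  · refine Or.inr (Or.inl ⟨by rw [h1]; ring, ?_⟩)
    convert h2 using 2; ring

lemma Meet_left (M N : SL2) (h : Meet (JJ * M) (JJ * N)) : Meet M N := by
  obtain ⟨H, H', h1, h2, h3⟩ := h
  refine ⟨JI * H * JJ, H', C0_conj _ h1, h2, ?_⟩
  calc JI * H * JJ * M = JI * (H * (JJ * M)) := by simp only [mul_assoc]
    _ = JI * JJ * (N * H') := by rw [h3]; simp only [mul_assoc]
    _ = N * H' := by rw [JI_mul_JJ, one_mul]

lemma Meet_right (M N : SL2) (h : Meet (M * JJ) (N * JJ)) : Meet M N := by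
  obtain ⟨H, H', h1, h2, h3⟩ := h
  refine ⟨H, JJ * H' * JI, h1, C0_conj' _ h2, ?_⟩
  calc H * M = H * M * (JJ * JI) := by rw [JJ_mul_JI, mul_one]
    _ = H * (M * JJ) * JI := by simp only [mul_assoc]
    _ = N * (JJ * H' * JI) := by rw [h3]; simp only [mul_assoc]

lemma corner (M N : SL2) (h : ¬ Meet M N) : M 1 0 ^ 2 < N 1 0 ^ 2 := by
  by_contra hle
  push Not at hle
  apply h
  have hM := sl_det M
  have hN := sl_det N
  set a := M 0 0
  set b := M 0 1
  set c := M 1 0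
  set d := M 1 1
  set a' := N 0 0
  set b' := N 0 1
  set c' := N 1 0
  set d' := N 1 1
  by_cases hc' : c' = 0
  · have ha' : a' * d' = 1 := by rw [hc'] at hN; linarith
    have ha0 : a' ≠ 0 := left_ne_zero_of_mul_eq_one ha'
    by_cases hc : c = 0
    · have ha : a * d = 1 := by rw [hc] at hM; linarith
      have ha1 : a ≠ 0 := left_ne_zero_of_mul_eq_one ha
      set p : ℝ := 1 + |a' / a|
      have hp : 1 ≤ p := by simp [p]
      have hp0 : p ≠ 0 := by positivity
      refine ⟨mkSL p 0 0 p⁻¹ (by field_simp; ring),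
        mkSL (d' * p * a) (d' * p * b - b' * d * p⁻¹) 0 (a' * d * p⁻¹) ?_, ?_, ?_, ?_⟩
      · have : d' * p * a * (a' * d * p⁻¹) = (a' * d') * (a * d) * (p * p⁻¹) := by ring
        rw [this, ha', ha, mul_inv_cancel₀ hp0]; ring
      · refine Or.inr (Or.inl ⟨rfl, ?_⟩)
        simp only [mkSL00]
        exact hp.trans (le_abs_self _)
      · refine Or.inr (Or.inl ⟨rfl, ?_⟩)
        simp only [mkSL00]
        have hd : d' = a'⁻¹ := by field_simp; linarith
        rw [hd, abs_mul, abs_mul, abs_inv]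
        have h1 : |a' / a| ≤ |p| := le_trans (by simp [p]) (le_abs_self _)
        rw [abs_div, div_le_iff₀ (abs_pos.2 ha1)] at h1
        have h2 : 0 < |a'| := abs_pos.2 ha0
        rw [mul_assoc, inv_mul_eq_div, le_div_iff₀ h2]
        linarith
      · rw [sl_eq_iff, mul00, mul01, mul10, mul11, mul00, mul01, mul10, mul11]
        simp only [mkSL00, mkSL01, mkSL10, mkSL11]
        change p * a + 0 * c = a' * (d' * p * a) + b' * 0 ∧
          p * b + 0 * d = a' * (d' * p * b - b' * d * p⁻¹) + b' * (a' * d * p⁻¹) ∧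
          0 * a + p⁻¹ * c = c' * (d' * p * a) + d' * 0 ∧
          0 * b + p⁻¹ * d = c' * (d' * p * b - b' * d * p⁻¹) + d' * (a' * d * p⁻¹)
        rw [hc, hc']
        refine ⟨?_, ?_, ?_, ?_⟩
        · linear_combination (-p * a) * ha'
        · linear_combination (-p * b) * ha'
        · ring
        · linear_combination (-p⁻¹ * d) * ha'
    · set s : ℝ := |a' * c|⁻¹
      have hac : a' * c ≠ 0 := mul_ne_zero ha0 hc
      have hs : 0 < s := inv_pos.2 (abs_pos.2 hac)
      have hs2 : a' ^ 2 * (s ^ 2 * c ^ 2) = 1 := by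
        have : s ^ 2 = ((a' * c) ^ 2)⁻¹ := by simp only [s, inv_pow, sq_abs]
        rw [this]; field_simp
      set r : ℝ := √(d ^ 2 + s ^ 2 * c ^ 2)
      have hpos : 0 < d ^ 2 + s ^ 2 * c ^ 2 := by positivity
      have hr : 0 < r := Real.sqrt_pos.2 hpos
      have hr2 : r ^ 2 = d ^ 2 + s ^ 2 * c ^ 2 := Real.sq_sqrt hpos.le
      set e : ℝ := (-(d / r) * b - s ^ 2 * (c / r) * a) with he
      have hd' : d' = a'⁻¹ := by field_simp; linarith
      let H' : SL2 := mkSL (d / r) (-s ^ 2 * (c / r)) (c / r) (d / r) (by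
        field_simp; linarith)
      have hrr : (d ^ 2 + s ^ 2 * c ^ 2) / r = r := by rw [← hr2]; field_simp
      let H2 : SL2 := mkSL r e 0 r⁻¹ (by field_simp; ring)
      have key : H2 * M = H' := by
        rw [sl_eq_iff, mul00, mul01, mul10, mul11]
        simp only [H2, H', mkSL00, mkSL01, mkSL10, mkSL11]
        change r * a + e * c = d / r ∧ r * b + e * d = -s ^ 2 * (c / r) ∧
          0 * a + r⁻¹ * c = c / r ∧ 0 * b + r⁻¹ * d = d / r
        refine ⟨?_, ?_, ?_, ?_⟩
        · rw [he]; field_simp; rw [hr2]; linear_combination d * hM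
        · rw [he]; field_simp; rw [hr2]; linear_combination (-s^2 * c) * hM
        · ring
        · ring
      refine ⟨N * H2, H', ?_, ?_, by rw [mul_assoc, key]⟩
      · refine Or.inr (Or.inl ⟨?_, ?_⟩)
        · rw [mul10]
          change c' * r + d' * 0 = 0
          rw [hc']; ring
        · rw [mul00]
          change 1 ≤ |a' * r + b' * 0|
          rw [← one_le_sq_iff_one_le_abs]
          have : (a' * r + b' * 0) ^ 2 = a' ^ 2 * r ^ 2 := by ring
          rw [this, hr2]
          nlinarith [sq_nonneg (a' * d)]
      · exact Or.inl ⟨s, hs, rfl, rfl⟩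
  · have hc : c ≠ 0 := by
      rintro h0
      rw [h0] at hle
      have := sq_pos_of_ne_zero hc'
      linarith
    set p : ℝ := c / c'
    have hp0 : p ≠ 0 := div_ne_zero hc hc'
    refine ⟨mkSL p ((a' - p * a) / c) 0 p⁻¹ (by field_simp; ring),
      mkSL 1 (d / c - d' / c') 0 1 (by ring), ?_, ?_, ?_⟩
    · refine Or.inr (Or.inl ⟨rfl, ?_⟩)
      simp only [mkSL00]
      rw [← one_le_sq_iff_one_le_abs, div_pow, le_div_iff₀ (by positivity)]
      linarith
    · exact Or.inr (Or.inl ⟨rfl, by simp⟩)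
    · rw [sl_eq_iff, mul00, mul01, mul10, mul11, mul00, mul01, mul10, mul11]
      simp only [mkSL00, mkSL01, mkSL10, mkSL11]
      change p * a + (a' - p * a) / c * c = a' * 1 + b' * 0 ∧
        p * b + (a' - p * a) / c * d = a' * (d / c - d' / c') + b' * 1 ∧
        0 * a + p⁻¹ * c = c' * 1 + d' * 0 ∧
        0 * b + p⁻¹ * d = c' * (d / c - d' / c') + d' * 1
      refine ⟨?_, ?_, ?_, ?_⟩
      · field_simp; ring
      · simp only [p]; field_simp; linear_combination (-c ) * hM + c * hN
      · simp only [p]; field_simp; ring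
      · simp only [p]; field_simp; ring

lemma dominated_of_not_inter (M N : SL2) (h : ¬ Meet M N) :
    M 0 0 ^ 2 < N 0 0 ^ 2 ∧ M 0 1 ^ 2 < N 0 1 ^ 2 ∧ M 1 0 ^ 2 < N 1 0 ^ 2 ∧
      M 1 1 ^ 2 < N 1 1 ^ 2 := by
  have h1 := corner M N h
  have h2 := corner _ _ (fun h' => h (Meet_left M N h'))
  have h3 := corner _ _ (fun h' => h (Meet_right M N h'))
  have h4 := corner _ _ (fun h' => h (Meet_left M N (Meet_right _ _ h')))
  simp only [mul10, mul11, JJ, mkSL00, mkSL10, mkSL11] at h2 h3 h4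
  refine ⟨?_, ?_, h1, ?_⟩
  · convert h2 using 1 <;> ring
  · convert h4 using 1 <;> ring
  · convert h3 using 1 <;> ring

lemma sq_le_one_of_mul {x y : ℝ} (h : x * y = 1) (hx : 1 ≤ |x|) : y ^ 2 ≤ 1 := by
  rw [← one_le_sq_iff_one_le_abs] at hx
  have h2 : x ^ 2 * y ^ 2 = 1 := by rw [← mul_pow, h]; norm_num
  nlinarith [sq_nonneg y]

lemma not_inter_of_dominated (M N : SL2) (ha : M 0 0 ^ 2 < N 0 0 ^ 2)
    (hb : M 0 1 ^ 2 < N 0 1 ^ 2) (hc : M 1 0 ^ 2 < N 1 0 ^ 2) (hd : M 1 1 ^ 2 < N 1 1 ^ 2) :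
    ¬ Meet M N := by
  rintro ⟨H, K, hH, hK, e⟩
  rw [sl_eq_iff, mul00, mul01, mul10, mul11, mul00, mul01, mul10, mul11] at e
  obtain ⟨e1, e2, e3, e4⟩ := e
  have dH := sl_det H
  have dK := sl_det K
  unfold C0 at hH hK
  generalize M 0 0 = a at *
  generalize M 0 1 = b at *
  generalize M 1 0 = c at *
  generalize M 1 1 = d at *
  generalize N 0 0 = a' at *
  generalize N 0 1 = b' at *
  generalize N 1 0 = c' at *
  generalize N 1 1 = d' at *
  generalize H 0 0 = p at *
  generalize H 0 1 = q at *
  generalize H 1 0 = r at *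
  generalize H 1 1 = w at *
  generalize K 0 0 = p' at *
  generalize K 0 1 = q' at *
  generalize K 1 0 = r' at *
  generalize K 1 1 = w' at *
  rcases hH with ⟨s, hs, h1, h2⟩ | ⟨h1, h2⟩ | ⟨h1, h2⟩ <;>
  rcases hK with ⟨t, ht, k1, k2⟩ | ⟨k1, k2⟩ | ⟨k1, k2⟩
  · subst h1 h2 k1 k2
    have A : t^2*a^2 + b^2 + s^2*t^2*c^2 + s^2*d^2
        = (p * p - -s ^ 2 * r * r) * (t^2*a^2 + b^2 + s^2*t^2*c^2 + s^2*d^2) := by rw [dH]; ring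
    have B : t^2*a'^2 + b'^2 + s^2*t^2*c'^2 + s^2*d'^2
        = (p' * p' - -t ^ 2 * r' * r') * (t^2*a'^2 + b'^2 + s^2*t^2*c'^2 + s^2*d'^2) := by
      rw [dK]; ring
    have C : t^2 * (p * a + -s ^ 2 * r * c)^2 + (p * b + -s ^ 2 * r * d)^2 +
      s^2*t^2*(r * a + p * c)^2 + s^2 * (r * b + p * d)^2 =
      t^2 * (a' * p' + b' * r')^2 + (a' * (-t ^ 2 * r') + b' * p')^2 +
      s^2*t^2*(c' * p' + d' * r')^2 + s^2 * (c' * (-t ^ 2 * r') + d' * p')^2 := by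
      rw [e1, e2, e3, e4]
    have D : t^2*a^2 + b^2 + s^2*t^2*c^2 + s^2*d^2 = t^2*a'^2 + b'^2 + s^2*t^2*c'^2 + s^2*d'^2 := by
      rw [A, B]; linear_combination C
    have : t^2*a^2 ≤ t^2*a'^2 := by gcongr
    have : s^2*t^2*c^2 ≤ s^2*t^2*c'^2 := by gcongr
    have : s^2*d^2 ≤ s^2*d'^2 := by gcongr
    linarith
  · subst h1 h2 k1
    have A : a^2 + s^2*c^2 = p'^2 * (a'^2+s^2*c'^2) := by
      have : a^2 + s^2*c^2 = (p * p - -s ^ 2 * r * r) * (a^2 + s^2*c^2) := by rw [dH]; ring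
      rw [this]
      have C : (p * a + -s ^ 2 * r * c)^2 + s^2 * (r * a + p * c)^2 =
        (a' * p' + b' * 0)^2 + s^2 * (c' * p' + d' * 0)^2 := by rw [e1, e3]
      linear_combination C
    rw [← one_le_sq_iff_one_le_abs] at k2
    have : s^2*c^2 ≤ s^2*c'^2 := by gcongr
    nlinarith [sq_nonneg a', sq_nonneg (s * c')]
  · subst h1 h2 k1
    have A : b^2 + s^2*d^2 = w'^2 * (b'^2+s^2*d'^2) := by
      have : b^2 + s^2*d^2 = (p * p - -s ^ 2 * r * r) * (b^2 + s^2*d^2) := by rw [dH]; ring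
      rw [this]
      have C : (p * b + -s ^ 2 * r * d)^2 + s^2 * (r * b + p * d)^2 =
        (a' * 0 + b' * w')^2 + s^2 * (c' * 0 + d' * w')^2 := by rw [e2, e4]
      linear_combination C
    rw [← one_le_sq_iff_one_le_abs] at k2
    have : s^2*d^2 ≤ s^2*d'^2 := by gcongr
    nlinarith [sq_nonneg b', sq_nonneg (s * d')]
  · subst h1 k1 k2
    have A : w^2 * (t^2*c^2 + d^2) = t^2*c'^2 + d'^2 := by
      have : t^2*c'^2 + d'^2 = (p' * p' - -t ^ 2 * r' * r') * (t^2*c'^2 + d'^2) := by rw [dK]; ring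
      rw [this]
      have C : t^2 * (0 * a + w * c)^2 + (0 * b + w * d)^2 =
        t^2 * (c' * p' + d' * r')^2 + (c' * (-t ^ 2 * r') + d' * p')^2 := by rw [e3, e4]
      linear_combination C
    have := sq_le_one_of_mul (by linarith : p * w = 1) h2
    have : t^2*c^2 ≤ t^2*c'^2 := by gcongr
    nlinarith [sq_nonneg d, sq_nonneg (t * c)]
  · subst h1 k1
    have := sq_le_one_of_mul (by linarith : p * w = 1) h2
    rw [← one_le_sq_iff_one_le_abs] at k2
    have C : w^2 * c^2 = c'^2 * p'^2 := by
      have : (0 * a + w * c)^2 = (c' * p' + d' * 0)^2 := by rw [e3]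
      linear_combination this
    nlinarith [sq_nonneg c, sq_nonneg c']
  · subst h1 k1
    have := sq_le_one_of_mul (by linarith : p * w = 1) h2
    rw [← one_le_sq_iff_one_le_abs] at k2
    have C : w^2 * d^2 = d'^2 * w'^2 := by
      have : (0 * b + w * d)^2 = (c' * 0 + d' * w')^2 := by rw [e4]
      linear_combination this
    nlinarith [sq_nonneg d, sq_nonneg d']
  · subst h1 k1 k2
    have A : p^2 * (t^2*a^2 + b^2) = t^2*a'^2 + b'^2 := by
      have : t^2*a'^2 + b'^2 = (p' * p' - -t ^ 2 * r' * r') * (t^2*a'^2 + b'^2) := by rw [dK]; ring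
      rw [this]
      have C : t^2 * (p * a + 0 * c)^2 + (p * b + 0 * d)^2 =
        t^2 * (a' * p' + b' * r')^2 + (a' * (-t ^ 2 * r') + b' * p')^2 := by rw [e1, e2]
      linear_combination C
    have := sq_le_one_of_mul (by linarith : w * p = 1) h2
    have : t^2*a^2 ≤ t^2*a'^2 := by gcongr
    nlinarith [sq_nonneg b, sq_nonneg (t * a)]
  · subst h1 k1
    have := sq_le_one_of_mul (by linarith : w * p = 1) h2
    rw [← one_le_sq_iff_one_le_abs] at k2
    have C : p^2 * a^2 = a'^2 * p'^2 := by
      have : (p * a + 0 * c)^2 = (a' * p' + b' * 0)^2 := by rw [e1]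
      linear_combination this
    nlinarith [sq_nonneg a, sq_nonneg a']
  · subst h1 k1
    have := sq_le_one_of_mul (by linarith : w * p = 1) h2
    rw [← one_le_sq_iff_one_le_abs] at k2
    have C : p^2 * b^2 = b'^2 * w'^2 := by
      have : (p * b + 0 * d)^2 = (a' * 0 + b' * w')^2 := by rw [e2]
      linear_combination this
    nlinarith [sq_nonneg b, sq_nonneg b']


lemma den_ne (H : SL2) (z : ℍ) : ((H 1 0 : ℝ) : ℂ) * z + ((H 1 1 : ℝ) : ℂ) ≠ 0 := by
  intro h
  have him := congrArg Complex.im h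
  have hre := congrArg Complex.re h
  simp at him hre
  have hc : H 1 0 = 0 := him.resolve_right z.im_ne_zero
  have hd : H 1 1 = 0 := by simpa [hc] using hre
  have := sl_det H
  rw [hc, hd] at this
  norm_num at this

lemma coe_sl (H : SL2) (z : ℍ) : ((H • z : ℍ) : ℂ) =
    (((H 0 0 : ℝ) : ℂ) * z + ((H 0 1 : ℝ) : ℂ)) / (((H 1 0 : ℝ) : ℂ) * z + ((H 1 1 : ℝ) : ℂ)) := by
  rw [UpperHalfPlane.coe_specialLinearGroup_apply]; rfl

lemma smul_iff (H : SL2) (z w : ℍ) : H • z = w ↔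
    ((H 0 0 : ℝ) : ℂ) * z + ((H 0 1 : ℝ) : ℂ) =
      w * (((H 1 0 : ℝ) : ℂ) * z + ((H 1 1 : ℝ) : ℂ)) := by
  rw [← UpperHalfPlane.coe_inj, coe_sl, div_eq_iff (den_ne H z)]

/-- The imaginary axis. -/
def ax (t : ℝ) : ℍ := UpperHalfPlane.mk ⟨0, Real.exp t⟩ (Real.exp_pos t)

lemma ax_re (t : ℝ) : (ax t).re = 0 := rfl
lemma ax_im (t : ℝ) : (ax t).im = Real.exp t := rfl
lemma ax_coe (t : ℝ) : ((ax t : ℍ) : ℂ) = Real.exp t * Complex.I := by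
  apply Complex.ext
  · change (0 : ℝ) = _
    simp
  · change Real.exp t = _
    simp [-Complex.ofReal_exp]

lemma den_pos (M : SL2) (t : ℝ) : 0 < M 1 0 ^ 2 * Real.exp t ^ 2 + M 1 1 ^ 2 := by
  have h := sl_det M
  have he := Real.exp_pos t
  by_cases hc : M 1 0 = 0
  · have : M 1 1 ≠ 0 := by
      intro h0; rw [hc, h0] at h; norm_num at h
    positivity
  · positivity

lemma smul_ax (M : SL2) (t : ℝ) :
    (M • ax t).re = (M 0 0 * M 1 0 * Real.exp t ^ 2 + M 0 1 * M 1 1) /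
      (M 1 0 ^ 2 * Real.exp t ^ 2 + M 1 1 ^ 2) ∧
    (M • ax t).im = Real.exp t / (M 1 0 ^ 2 * Real.exp t ^ 2 + M 1 1 ^ 2) := by
  have hD := den_pos M t
  have hdet := sl_det M
  have h : (M • ax t : ℍ) = UpperHalfPlane.mk ⟨(M 0 0 * M 1 0 * Real.exp t ^ 2 + M 0 1 * M 1 1) /
      (M 1 0 ^ 2 * Real.exp t ^ 2 + M 1 1 ^ 2),
      Real.exp t / (M 1 0 ^ 2 * Real.exp t ^ 2 + M 1 1 ^ 2)⟩ (div_pos (Real.exp_pos t) hD) := by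
    rw [smul_iff, ax_coe]
    apply Complex.ext
    · simp [-Complex.ofReal_exp]
      field_simp
      linear_combination (-Real.exp t ^ 2 * M 1 0) * hdet
    · simp [-Complex.ofReal_exp]
      have he := Real.exp_pos t
      generalize Real.exp t = y at *
      generalize M 0 0 = a at *
      generalize M 0 1 = b at *
      generalize M 1 0 = c at *
      generalize M 1 1 = d at *
      rw [div_mul_eq_mul_div, div_mul_eq_mul_div, ← add_div, eq_div_iff hD.ne']
      linear_combination (y * d) * hdet
  rw [h]
  exact ⟨rfl, rfl⟩

/-- Twice the hyperbolic cosine of the distance from `ax u` to `M • ax t`. -/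
def QQ (M : SL2) (u t : ℝ) : ℝ :=
  M 0 0 ^ 2 * Real.exp (t - u) + M 0 1 ^ 2 * Real.exp (- u - t) +
    M 1 0 ^ 2 * Real.exp (u + t) + M 1 1 ^ 2 * Real.exp (u - t)

lemma cosh_ax (M : SL2) (u t : ℝ) : Real.cosh (dist (ax u) (M • ax t)) = QQ M u t / 2 := by
  rw [UpperHalfPlane.cosh_dist', (smul_ax M t).1, (smul_ax M t).2, ax_re, ax_im]
  have hD := den_pos M t
  have hdet := sl_det M
  unfold QQ
  rw [Real.exp_sub, Real.exp_sub, Real.exp_sub, Real.exp_add, Real.exp_neg]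
  have h1 := Real.exp_pos u
  have h2 := Real.exp_pos t
  generalize Real.exp u = x at *
  generalize Real.exp t = y at *
  field_simp
  generalize M 0 0 = a at *
  generalize M 0 1 = b at *
  generalize M 1 0 = c at *
  generalize M 1 1 = d at *
  linear_combination (-y ^ 2 * (a * d - b * c + 1)) * hdet

lemma fix_iff (H : SL2) (t : ℝ) : H • ax t = ax t ↔
    H 0 0 = H 1 1 ∧ H 0 1 = - (Real.exp t)^2 * H 1 0 := by
  rw [smul_iff, ax_coe, Complex.ext_iff]
  simp [-Complex.ofReal_exp]
  have := Real.exp_pos t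
  constructor
  · rintro ⟨h1, h2⟩
    refine ⟨?_, by rw [h1]; ring⟩
    apply mul_right_cancel₀ this.ne'
    rw [h2]; ring
  · rintro ⟨h1, h2⟩
    exact ⟨by rw [h2]; ring, by rw [h1]; ring⟩

lemma isometry_ax : Isometry ax := UpperHalfPlane.isometry_vertical_line 0

lemma ax_zero : ax 0 = UpperHalfPlane.I := by
  apply UpperHalfPlane.ext
  rw [ax_coe]; simp

lemma rotate (z w : ℍ) (h : dist (ax 0) z = dist (ax 0) w) :
    ∃ R : SL2, R • ax 0 = ax 0 ∧ R • z = w := by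
  by_cases hzw : z = w
  · exact ⟨1, by simp, by simp [hzw]⟩
  have h1 := congrArg Real.cosh h
  rw [UpperHalfPlane.cosh_dist', UpperHalfPlane.cosh_dist', ax_re, ax_im, Real.exp_zero] at h1
  have hz := z.im_pos
  have hw := w.im_pos
  field_simp at h1
  have hne : (z : ℂ) - w ≠ 0 := sub_ne_zero.2 (fun h => hzw (UpperHalfPlane.ext h))
  have hreal : ∃ τ : ℝ, (w * z + 1 : ℂ) = τ * ((z : ℂ) - w) := by
    refine ⟨((w * z + 1 : ℂ) / ((z : ℂ) - w)).re, ?_⟩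
    have : ((((w * z + 1 : ℂ) / ((z : ℂ) - w)).re : ℝ) : ℂ) = (w * z + 1 : ℂ) / ((z : ℂ) - w) := by
      apply Complex.ext
      · simp
      · rw [Complex.ofReal_im, Complex.div_im, eq_comm, ← sub_div]
        apply div_eq_zero_iff.2 (Or.inl _)
        simp
        linear_combination h1
    rw [this, div_mul_cancel₀ _ hne]
  obtain ⟨τ, hτ⟩ := hreal
  set r : ℝ := √(1 + τ^2)
  have hpos : 0 < 1 + τ^2 := by positivity
  have hr : 0 < r := Real.sqrt_pos.2 hpos
  have hr2 : r^2 = 1 + τ^2 := Real.sq_sqrt hpos.le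
  refine ⟨mkSL (τ / r) (-(1 / r)) (1 / r) (τ / r) (by field_simp; linarith), ?_, ?_⟩
  · rw [fix_iff]; simp
  · rw [smul_iff]
    simp only [mkSL00, mkSL01, mkSL10, mkSL11]
    push_cast
    have : (r : ℂ) ≠ 0 := by exact_mod_cast hr.ne'
    field_simp
    linear_combination -hτ

lemma classify (γ : ℝ → ℍ) (hγ : Isometry γ) : ∃ A : SL2, ∀ t, γ t = A • ax t := by
  set B := (γ 0).toSL2R
  have hB : B • ax 0 = γ 0 := by rw [ax_zero]; exact UpperHalfPlane.toSL2R_smul_I _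
  have hB' : B⁻¹ • γ 0 = ax 0 := by rw [← hB, inv_smul_smul]
  obtain ⟨R, hR1, hR2⟩ := rotate (ax 1) (B⁻¹ • γ 1) (by
    rw [isometry_ax.dist_eq, ← hB', dist_smul, hγ.dist_eq])
  refine ⟨B * R, fun t => ?_⟩
  suffices hz : (B * R)⁻¹ • γ t = ax t by rw [← hz, smul_inv_smul]
  have h0 : (B * R)⁻¹ • γ 0 = ax 0 := by
    rw [inv_smul_eq_iff, mul_smul, hR1, hB]
  have h1 : (B * R)⁻¹ • γ 1 = ax 1 := by
    rw [inv_smul_eq_iff, mul_smul, hR2, smul_inv_smul]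
  have d0 : dist (ax 0) ((B * R)⁻¹ • γ t) = dist (ax 0) (ax t) := by
    rw [isometry_ax.dist_eq, ← h0, dist_smul, hγ.dist_eq]
  have d1 : dist (ax 1) ((B * R)⁻¹ • γ t) = dist (ax 1) (ax t) := by
    rw [isometry_ax.dist_eq, ← h1, dist_smul, hγ.dist_eq]
  generalize (B * R)⁻¹ • γ t = z at *
  have e0 := congrArg Real.cosh d0
  have e1 := congrArg Real.cosh d1
  rw [UpperHalfPlane.cosh_dist', UpperHalfPlane.cosh_dist'] at e0 e1
  simp only [ax_re, ax_im] at e0 e1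
  rw [Real.exp_zero] at e0
  have hz := z.im_pos
  have ht := Real.exp_pos t
  have he : 1 < Real.exp 1 := Real.one_lt_exp_iff.2 one_pos
  generalize hy : Real.exp t = y at *
  generalize Real.exp 1 = e at *
  have he0 : 0 < e := by linarith
  field_simp at e0 e1
  have him : z.im = y := by
    have h2 : (z.im - y) * (e^2 - 1) = 0 := by
      linear_combination e0 - e1
    rcases mul_eq_zero.1 h2 with h | h
    · linarith
    · nlinarith
  have hre : z.re = 0 := by
    rw [him] at e0
    have h3 : y * z.re^2 = 0 := by linear_combination e0
    rcases mul_eq_zero.1 h3 with h | h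
    · linarith
    · exact pow_eq_zero_iff (two_ne_zero) |>.1 h
  exact UpperHalfPlane.ext_re_im (by rw [hre, ax_re]) (by rw [him, ax_im, hy])


lemma mk_eq_iff (A B : SL2) : (QuotientGroup.mk A : PSL2) = QuotientGroup.mk B ↔
    A = B ∨ A = -B := by
  rw [QuotientGroup.eq, Matrix.SpecialLinearGroup.mem_center_iff]
  constructor
  · rintro ⟨r, hr, h⟩
    have hr' : r = 1 ∨ r = -1 := by
      rw [Fintype.card_fin] at hr
      have h0 : (r - 1) * (r + 1) = 0 := by linear_combination hr
      rcases mul_eq_zero.1 h0 with h | h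
      · left; linarith
      · right; linarith
    have key : ∀ i j, B i j = r * A i j := by
      intro i j
      have h2 : B = A * (A⁻¹ * B) := by group
      have h3 : (B : Matrix (Fin 2) (Fin 2) ℝ) = A * Matrix.scalar (Fin 2) r := by
        rw [h, ← Matrix.SpecialLinearGroup.coe_mul, ← h2]
      rw [h3]
      simp [Matrix.scalar_apply, mul_comm]
    rcases hr' with rfl | rfl
    · left; ext i j; rw [key]; ring
    · right; ext i j
      simp [key]
  · rintro (rfl | rfl)
    · exact ⟨1, by simp, by simp⟩
    · refine ⟨-1, by simp, ?_⟩
      have : (-B)⁻¹ * B = -1 := by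
        rw [inv_mul_eq_iff_eq_mul]; simp
      rw [this]
      ext i j
      fin_cases i <;> fin_cases j <;> simp

lemma neg_smul_sl (A : SL2) (z : ℍ) : (-A) • z = A • z := by
  rw [smul_iff, coe_sl]
  have := den_ne A z
  simp only [Matrix.SpecialLinearGroup.coe_neg, Matrix.neg_apply]
  push_cast
  rw [div_mul_eq_mul_div, eq_div_iff this]
  ring

lemma pslSMul_mk (A : SL2) (z : ℍ) : pslSMul (QuotientGroup.mk A) z = A • z := by
  unfold pslSMul
  have h : (QuotientGroup.mk (Quotient.out (QuotientGroup.mk A : PSL2)) : PSL2) =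
      QuotientGroup.mk A := Quotient.out_eq _
  rcases (mk_eq_iff _ _).1 h with h | h
  · rw [h]
  · rw [h, neg_smul_sl]

lemma C0_neg (H : SL2) (h : C0 H) : C0 (-H) := by
  unfold C0 at *
  simp only [Matrix.SpecialLinearGroup.coe_neg, Matrix.neg_apply, abs_neg]
  rcases h with ⟨s, hs, h1, h2⟩ | ⟨h1, h2⟩ | ⟨h1, h2⟩
  · exact Or.inl ⟨s, hs, by rw [h1], by rw [h2]; ring⟩
  · exact Or.inr (Or.inl ⟨by rw [h1]; simp, h2⟩)
  · exact Or.inr (Or.inr ⟨by rw [h1]; simp, h2⟩)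

/-- The first column of `B` represents the boundary point `ξ`. -/
def Col (B : SL2) (ξ : OnePoint ℝ) : Prop :=
  ∃ r : ℝ, r ≠ 0 ∧ B 0 0 = r * bvec ξ 0 ∧ B 1 0 = r * bvec ξ 1

@[simp] lemma bvec_inf : bvec OnePoint.infty = ![1, 0] := rfl
@[simp] lemma bvec_coe (x : ℝ) : bvec (x : OnePoint ℝ) = ![x, 1] := rfl

lemma Col_unique (B : SL2) (ξ η : OnePoint ℝ) (h : Col B ξ) (h' : Col B η) : ξ = η := by
  obtain ⟨r, hr, h1, h2⟩ := h
  obtain ⟨r', hr', h3, h4⟩ := h'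
  induction ξ using OnePoint.rec with
  | infty =>
    induction η using OnePoint.rec with
    | infty => rfl
    | coe y =>
      simp at h2 h4
      exact absurd (h4.symm.trans h2) hr'
  | coe x =>
    induction η using OnePoint.rec with
    | infty =>
      simp at h2 h4
      exact absurd (h2.symm.trans h4) hr
    | coe y =>
      simp at h1 h2 h3 h4
      have : r = r' := h2.symm.trans h4
      subst this
      rw [h1] at h3
      rw [mul_left_cancel₀ hr h3]

lemma tendsto_lin (c d : ℝ) (hc : c ≠ 0) :
    Tendsto (fun t : ℝ => (c : ℂ) * (ax t : ℂ) + d) atTop (Bornology.cobounded ℂ) := by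
  rw [← tendsto_norm_atTop_iff_cobounded]
  have h1 : Tendsto (fun t : ℝ => |c| * Real.exp t) atTop atTop :=
    Real.tendsto_exp_atTop.const_mul_atTop (abs_pos.2 hc)
  refine tendsto_atTop_mono (fun t => ?_) h1
  have h2 := Complex.abs_im_le_norm ((c : ℂ) * (ax t : ℂ) + d)
  rw [ax_coe] at h2 ⊢
  simpa [-Complex.ofReal_exp, abs_mul] using h2

lemma lim_ax (B : SL2) : ∃ ξ, Col B ξ ∧
    Tendsto (fun t => embH (B • ax t)) atTop (𝓝 (toC ξ)) := by
  have hdet := sl_det B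
  by_cases hc : B 1 0 = 0
  · have hd : B 0 0 * B 1 1 = 1 := by rw [hc] at hdet; linarith
    have ha0 : B 0 0 ≠ 0 := left_ne_zero_of_mul_eq_one hd
    have hd0 : B 1 1 ≠ 0 := right_ne_zero_of_mul_eq_one hd
    refine ⟨OnePoint.infty, ⟨B 0 0, ha0, by simp, by simp [hc]⟩, ?_⟩
    have h1 := tendsto_lin (B 0 0 / B 1 1) (B 0 1 / B 1 1) (div_ne_zero ha0 hd0)
    have h2 : Tendsto (fun w : ℂ => (w : OnePoint ℂ)) (Bornology.cobounded ℂ)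
        (𝓝 OnePoint.infty) := by
      rw [Metric.cobounded_eq_cocompact, ← coclosedCompact_eq_cocompact]
      exact OnePoint.tendsto_coe_infty
    have h3 := h2.comp h1
    refine h3.congr (fun t => ?_)
    simp only [Function.comp, embH]
    rw [coe_sl, hc]
    have : (B 1 1 : ℂ) ≠ 0 := by exact_mod_cast hd0
    congr 1
    push_cast
    rw [zero_mul, zero_add]
    ring
  · refine ⟨((B 0 0 / B 1 0 : ℝ) : OnePoint ℝ), ⟨B 1 0, hc, ?_, by simp⟩, ?_⟩
    · simp; field_simp
    · have h1 := tendsto_lin (B 1 0) (B 1 1) hc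
      have h2 := (tendsto_inv₀_cobounded.comp h1).const_mul (-(1 / B 1 0 : ℂ))
      have h3 := h2.const_add ((B 0 0 / B 1 0 : ℝ) : ℂ)
      rw [mul_zero, add_zero] at h3
      have h4 := (OnePoint.continuous_coe.tendsto ((B 0 0 / B 1 0 : ℝ) : ℂ)).comp h3
      refine h4.congr (fun t => ?_)
      simp only [Function.comp, embH]
      congr 1
      rw [coe_sl]
      have hn := den_ne B (ax t)
      have hcc : (B 1 0 : ℂ) ≠ 0 := by exact_mod_cast hc
      have hdc : (B 0 0 : ℂ) * B 1 1 - B 0 1 * B 1 0 = 1 := by exact_mod_cast hdet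
      push_cast
      field_simp
      linear_combination hdc

lemma toC_inj : Function.Injective toC := Option.map_injective Complex.ofReal_injective

lemma JJ_ax (t : ℝ) : JJ • ax t = ax (-t) := by
  rw [smul_iff, ax_coe, ax_coe]
  simp [JJ, -Complex.ofReal_exp]
  have h : ((Real.exp (-t) : ℝ) : ℂ) * (Real.exp t : ℝ) = 1 := by
    rw [← Complex.ofReal_mul, ← Real.exp_add]; simp
  linear_combination (1 : ℂ) * h - (Real.exp (-t) : ℝ) * (Real.exp t : ℝ) * Complex.I_mul_I

lemma stab (D : SL2) (h : ∀ t, (D • ax t).re = 0) :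
    (D 1 0 = 0 ∧ D 0 1 = 0) ∨ (D 0 0 = 0 ∧ D 1 1 = 0) := by
  have hdet := sl_det D
  have key : ∀ t, D 0 0 * D 1 0 * Real.exp t ^ 2 + D 0 1 * D 1 1 = 0 := by
    intro t
    have h1 := h t
    rw [(smul_ax D t).1, div_eq_zero_iff] at h1
    exact h1.resolve_right (den_pos D t).ne'
  have k0 := key 0
  have k1 := key 1
  have he : 1 < Real.exp 1 := Real.one_lt_exp_iff.2 one_pos
  rw [Real.exp_zero] at k0
  have h2 : D 0 0 * D 1 0 * (Real.exp 1 ^ 2 - 1) = 0 := by linear_combination k1 - k0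
  have h3 : D 0 0 * D 1 0 = 0 := by
    rcases mul_eq_zero.1 h2 with h | h
    · exact h
    · nlinarith
  have h4 : D 0 1 * D 1 1 = 0 := by rw [h3] at k0; linarith
  rcases mul_eq_zero.1 h3 with h | h
  · right
    refine ⟨h, ?_⟩
    rcases mul_eq_zero.1 h4 with h' | h'
    · rw [h, h'] at hdet; norm_num at hdet
    · exact h'
  · left
    refine ⟨h, ?_⟩
    rcases mul_eq_zero.1 h4 with h' | h'
    · exact h'
    · rw [h, h'] at hdet; norm_num at hdet

lemma endpoint_iff (A : SL2) (ξ : OnePoint ℝ) :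
    IsEndpoint (Set.range fun t => A • ax t) ξ ↔ Col A ξ ∨ Col (A * JJ) ξ := by
  have iso : ∀ B : SL2, Isometry (fun t => B • ax t) := fun B =>
    (isometry_smul ℍ B).comp isometry_ax
  constructor
  · rintro ⟨γ, hγ, hr, hlim⟩
    obtain ⟨B, hB⟩ := classify γ hγ
    obtain ⟨η, hη, hl⟩ := lim_ax B
    have hγB : γ = fun t => B • ax t := funext hB
    subst hγB
    have : η = ξ := toC_inj (tendsto_nhds_unique hl hlim)
    subst this
    obtain ⟨D, hD⟩ : ∃ D, B = A * D := ⟨A⁻¹ * B, by group⟩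
    have hst := stab D (by
      intro t
      have h1 : B • ax t ∈ Set.range fun t => A • ax t := by
        rw [← hr]; exact ⟨t, rfl⟩
      obtain ⟨u, hu⟩ := h1
      simp only [hD, mul_smul, smul_left_cancel_iff] at hu
      rw [← hu, ax_re])
    have hdet := sl_det D
    obtain ⟨r, hr0, h1, h2⟩ := hη
    rw [hD, mul00] at h1
    rw [hD, mul10] at h2
    rcases hst with ⟨h3, h4⟩ | ⟨h3, h4⟩
    · left
      have hd : D 0 0 ≠ 0 := by
        intro h; rw [h, h3] at hdet; norm_num at hdet
      refine ⟨r / D 0 0, div_ne_zero hr0 hd, ?_, ?_⟩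
      · field_simp; rw [← h1, h3]; ring
      · field_simp; rw [← h2, h3]; ring
    · right
      have hd : D 1 0 ≠ 0 := by
        intro h; rw [h, h3] at hdet; norm_num at hdet
      refine ⟨r / D 1 0, div_ne_zero hr0 hd, ?_, ?_⟩
      · rw [mul00]; simp only [JJ, mkSL00, mkSL10]; field_simp; rw [← h1, h3]; ring
      · rw [mul10]; simp only [JJ, mkSL00, mkSL10]; field_simp; rw [← h2, h3]; ring
  · rintro (h | h)
    · obtain ⟨η, hη, hl⟩ := lim_ax A
      rw [Col_unique A ξ η h hη]
      exact ⟨_, iso A, rfl, hl⟩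
    · obtain ⟨η, hη, hl⟩ := lim_ax (A * JJ)
      rw [Col_unique _ ξ η h hη]
      refine ⟨_, iso _, ?_, hl⟩
      ext z
      constructor
      · rintro ⟨t, rfl⟩
        exact ⟨-t, by simp only [mul_smul, JJ_ax]⟩
      · rintro ⟨t, rfl⟩
        exact ⟨-t, by simp only [mul_smul, JJ_ax, neg_neg]⟩

lemma nonrep_mk (X : SL2) (ξ : OnePoint ℝ) : HasNonrepelling (QuotientGroup.mk X) ξ ↔
    ∃ μ : ℝ, 1 ≤ |μ| ∧ X 0 0 * bvec ξ 0 + X 0 1 * bvec ξ 1 = μ * bvec ξ 0 ∧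
      X 1 0 * bvec ξ 0 + X 1 1 * bvec ξ 1 = μ * bvec ξ 1 := by
  have expand : ∀ (Y : SL2) (μ : ℝ),
      (Y : Matrix (Fin 2) (Fin 2) ℝ).mulVec (bvec ξ) = μ • bvec ξ ↔
      Y 0 0 * bvec ξ 0 + Y 0 1 * bvec ξ 1 = μ * bvec ξ 0 ∧
      Y 1 0 * bvec ξ 0 + Y 1 1 * bvec ξ 1 = μ * bvec ξ 1 := by
    intro Y μ
    rw [funext_iff, Fin.forall_fin_two]
    simp [Matrix.mulVec, dotProduct, Fin.sum_univ_two]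
  constructor
  · rintro ⟨Y, hY, μ, hμ, h⟩
    rw [expand] at h
    rcases (mk_eq_iff _ _).1 hY with rfl | rfl
    · exact ⟨μ, hμ, h⟩
    · refine ⟨-μ, by rwa [abs_neg], ?_⟩
      simp only [Matrix.SpecialLinearGroup.coe_neg, Matrix.neg_apply] at h
      exact ⟨by linarith [h.1], by linarith [h.2]⟩
  · rintro ⟨μ, hμ, h⟩
    exact ⟨X, rfl, μ, hμ, (expand X μ).2 h⟩

lemma nonrep_iff (B X Y : SL2) (hY : X * B = B * Y) (ξ : OnePoint ℝ) (hξ : Col B ξ) :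
    HasNonrepelling (QuotientGroup.mk X) ξ ↔ Y 1 0 = 0 ∧ 1 ≤ |Y 0 0| := by
  rw [nonrep_mk]
  obtain ⟨r, hr, h1, h2⟩ := hξ
  rw [sl_eq_iff, mul00, mul01, mul10, mul11, mul00, mul01, mul10, mul11] at hY
  obtain ⟨e1, -, e3, -⟩ := hY
  have hdet := sl_det B
  constructor
  · rintro ⟨μ, hμ, f1, f2⟩
    have g1 : μ * B 0 0 = B 0 0 * Y 0 0 + B 0 1 * Y 1 0 := by
      rw [← e1, h1, h2]; linear_combination (-r) * f1
    have g2 : μ * B 1 0 = B 1 0 * Y 0 0 + B 1 1 * Y 1 0 := by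
      rw [← e3, h1, h2]; linear_combination (-r) * f2
    have k1 : Y 1 0 = 0 := by
      linear_combination (-Y 1 0) * hdet - B 0 0 * g2 + B 1 0 * g1
    have k2 : Y 0 0 = μ := by
      linear_combination (-(Y 0 0 - μ)) * hdet - B 1 1 * g1 + B 0 1 * g2
    exact ⟨k1, by rwa [k2]⟩
  · rintro ⟨k1, k2⟩
    refine ⟨Y 0 0, k2, ?_, ?_⟩
    · apply mul_left_cancel₀ hr
      rw [k1, h1, h2] at e1
      linear_combination e1
    · apply mul_left_cancel₀ hr
      rw [k1, h1, h2] at e3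
      linear_combination e3

lemma mem_crooked (A X : SL2) :
    (QuotientGroup.mk X : PSL2) ∈ leftCrooked (Set.range fun t => A • ax t) ↔
      C0 (A⁻¹ * X * A) := by
  set Y := A⁻¹ * X * A with hY
  have hXA : X * A = A * Y := by rw [hY]; group
  have hXA2 : X * (A * JJ) = (A * JJ) * (JI * Y * JJ) := by
    calc X * (A * JJ) = A * Y * JJ := by rw [← mul_assoc, hXA]
      _ = A * (JJ * JI) * Y * JJ := by rw [JJ_mul_JI, mul_one]
      _ = _ := by simp only [mul_assoc]
  have h00 : (JI * Y * JJ) 0 0 = Y 1 1 := by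
    simp [mul00, mul01, JJ, JI]
  have h10 : (JI * Y * JJ) 1 0 = - Y 0 1 := by
    simp [mul10, mul11, JJ, JI]
  change ((∃ x ∈ _, _) ∨ ∃ ξ, _) ↔ _
  unfold C0
  refine or_congr ?_ ?_
  · constructor
    · rintro ⟨x, ⟨t, rfl⟩, h⟩
      rw [pslSMul_mk] at h
      have h2 : Y • ax t = ax t := by
        rw [hY, mul_smul, mul_smul]
        simp only at h
        rw [h, inv_smul_smul]
      rw [fix_iff] at h2
      exact ⟨Real.exp t, Real.exp_pos t, h2⟩
    · rintro ⟨s, hs, h⟩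
      refine ⟨A • ax (Real.log s), ⟨_, rfl⟩, ?_⟩
      rw [← Real.exp_log hs, ← fix_iff] at h
      rw [pslSMul_mk, ← mul_smul, hXA, mul_smul, h]
  · constructor
    · rintro ⟨ξ, hξ, h⟩
      rcases (endpoint_iff A ξ).1 hξ with hc | hc
      · exact Or.inl ((nonrep_iff A X Y hXA ξ hc).1 h)
      · have := (nonrep_iff _ X _ hXA2 ξ hc).1 h
        rw [h00, h10, neg_eq_zero] at this
        exact Or.inr this
    · rintro (h | h)
      · obtain ⟨ξ, hξ, -⟩ := lim_ax A
        exact ⟨ξ, (endpoint_iff A ξ).2 (Or.inl hξ), (nonrep_iff A X Y hXA ξ hξ).2 h⟩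
      · obtain ⟨ξ, hξ, -⟩ := lim_ax (A * JJ)
        refine ⟨ξ, (endpoint_iff A ξ).2 (Or.inr hξ), (nonrep_iff _ X _ hXA2 ξ hξ).2 ?_⟩
        rwa [h00, h10, neg_eq_zero]


lemma two_le_QQ (M : SL2) (u t : ℝ) : 2 ≤ QQ M u t := by
  have := Real.one_le_cosh (dist (ax u) (M • ax t))
  rw [cosh_ax] at this
  linarith

lemma QQ_left (M : SL2) (u t : ℝ) : QQ (JJ * M) u t = QQ M (-u) t := by
  unfold QQ
  simp only [mul00, mul01, mul10, mul11, JJ, mkSL00, mkSL01, mkSL10, mkSL11]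
  rw [show t - -u = u + t by ring, show - -u - t = u - t by ring, show -u + t = t - u by ring]
  ring

lemma QQ_right (M : SL2) (u t : ℝ) : QQ (M * JJ) u t = QQ M u (-t) := by
  unfold QQ
  simp only [mul00, mul01, mul10, mul11, JJ, mkSL00, mkSL01, mkSL10, mkSL11]
  rw [show -t - u = -u - t by ring, show -u - -t = t - u by ring, show u - -t = u + t by ring,
    show u + -t = u - t by ring]
  ring

lemma dom_corner (M N : SL2) (k : ℝ) (hk : 1 < k) (h : ∀ u t, k * QQ M u t ≤ QQ N u t) :
    M 1 0 ^ 2 < N 1 0 ^ 2 := by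
  have h1 : k * M 1 0 ^ 2 ≤ N 1 0 ^ 2 := by
    by_contra hlt
    push Not at hlt
    set δ := k * M 1 0 ^ 2 - N 1 0 ^ 2
    have hδ : 0 < δ := by simp only [δ]; linarith
    set E := N 0 0 ^ 2 + N 0 1 ^ 2 + N 1 1 ^ 2
    have hE : 0 ≤ E := by positivity
    set T := Real.log (E / δ + 2)
    have hpos : 0 < E / δ + 2 := by positivity
    have hT : Real.exp T = E / δ + 2 := Real.exp_log hpos
    have hT0 : 0 ≤ T := Real.log_nonneg (by have : 0 ≤ E / δ := by positivity
                                            linarith)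
    have h2 := h (T / 2) (T / 2)
    unfold QQ at h2
    rw [show T / 2 - T / 2 = 0 by ring, show -(T / 2) - T / 2 = -T by ring,
      show T / 2 + T / 2 = T by ring, Real.exp_zero] at h2
    have h3 : Real.exp (-T) ≤ 1 := Real.exp_le_one_iff.2 (by linarith)
    have h4 := Real.exp_pos (-T)
    have h5 : N 0 1 ^ 2 * Real.exp (-T) ≤ N 0 1 ^ 2 := by
      have := sq_nonneg (N 0 1)
      nlinarith
    have h6 : 0 ≤ k * (M 0 0 ^ 2 * 1 + M 0 1 ^ 2 * Real.exp (-T) + M 1 1 ^ 2 * 1) := by positivity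
    have h7 : δ * Real.exp T ≤ E := by simp only [δ, E]; linarith
    rw [hT] at h7
    have h8 : δ * (E / δ + 2) = E + 2 * δ := by field_simp
    linarith
  have h2 : N 1 0 ≠ 0 := by
    intro hc
    have hdet := sl_det N
    have had : N 0 0 * N 1 1 = 1 := by rw [hc] at hdet; linarith
    have ha0 : N 0 0 ≠ 0 := left_ne_zero_of_mul_eq_one had
    have hd : N 1 1 = (N 0 0)⁻¹ := by field_simp; linarith
    set L := Real.log (N 0 0 ^ 2)
    have hL : Real.exp L = N 0 0 ^ 2 := Real.exp_log (by positivity)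
    set T := Real.log (N 0 1 ^ 2 / (k - 1) + 1)
    have hk1 : 0 < k - 1 := by linarith
    have hT : Real.exp T = N 0 1 ^ 2 / (k - 1) + 1 := Real.exp_log (by positivity)
    have h2 := h ((T + L) / 2) ((T - L) / 2)
    have h3 := two_le_QQ M ((T + L) / 2) ((T - L) / 2)
    have h4 : QQ N ((T + L) / 2) ((T - L) / 2) = 2 + N 0 1 ^ 2 / Real.exp T := by
      unfold QQ
      rw [hc, hd, show (T - L) / 2 - (T + L) / 2 = -L by ring,
        show -((T + L) / 2) - (T - L) / 2 = -T by ring,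
        show (T + L) / 2 - (T - L) / 2 = L by ring, Real.exp_neg, Real.exp_neg, hL]
      field_simp
      ring
    rw [h4] at h2
    have h5 : N 0 1 ^ 2 / Real.exp T ≤ k - 1 := by
      rw [div_le_iff₀ (Real.exp_pos T), hT]
      have : (k - 1) * (N 0 1 ^ 2 / (k - 1) + 1) = N 0 1 ^ 2 + (k - 1) := by field_simp
      linarith
    nlinarith
  have h3 : 0 < N 1 0 ^ 2 := by positivity
  have := sq_nonneg (M 1 0)
  nlinarith

lemma dominated_iff (M N : SL2) :
    (M 0 0 ^ 2 < N 0 0 ^ 2 ∧ M 0 1 ^ 2 < N 0 1 ^ 2 ∧ M 1 0 ^ 2 < N 1 0 ^ 2 ∧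
      M 1 1 ^ 2 < N 1 1 ^ 2) ↔
    ∃ K > 0, ∀ u t, dist (ax u) (M • ax t) + K ≤ dist (ax u) (N • ax t) := by
  constructor
  · rintro ⟨ha, hb, hc, hd⟩
    have ev : ∀ m n : ℝ, m < n → ∀ᶠ k : ℝ in 𝓝[>] 1, k * m < n := by
      intro m n hmn
      have : Tendsto (fun k : ℝ => k * m) (𝓝 1) (𝓝 (1 * m)) :=
        (continuous_id.mul continuous_const).tendsto 1
      rw [one_mul] at this
      exact (this.eventually (gt_mem_nhds hmn)).filter_mono nhdsWithin_le_nhds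
    obtain ⟨k, ⟨⟨⟨h1, h2⟩, h3⟩, h4⟩, hk⟩ := ((((ev _ _ ha).and (ev _ _ hb)).and
      (ev _ _ hc)).and (ev _ _ hd)).and self_mem_nhdsWithin |>.exists
    have hk : 1 < k := hk
    refine ⟨Real.log k, Real.log_pos hk, fun u t => ?_⟩
    have hQ : k * QQ M u t ≤ QQ N u t := by
      unfold QQ
      have f1 := mul_le_mul_of_nonneg_right h1.le (Real.exp_pos (t - u)).le
      have f2 := mul_le_mul_of_nonneg_right h2.le (Real.exp_pos (-u - t)).le
      have f3 := mul_le_mul_of_nonneg_right h3.le (Real.exp_pos (u + t)).le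
      have f4 := mul_le_mul_of_nonneg_right h4.le (Real.exp_pos (u - t)).le
      linarith
    have hd0 : 0 ≤ dist (ax u) (M • ax t) := dist_nonneg
    have hlog := Real.log_pos hk
    have hcosh : Real.cosh (dist (ax u) (M • ax t) + Real.log k) ≤
        Real.cosh (dist (ax u) (N • ax t)) := by
      rw [cosh_ax N]
      refine le_trans ?_ (by linarith : k * (QQ M u t / 2) ≤ _)
      rw [← cosh_ax M, Real.cosh_eq, Real.cosh_eq, Real.exp_add, Real.exp_log (by linarith),
        neg_add, Real.exp_add, Real.exp_neg (Real.log k), Real.exp_log (by linarith)]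
      have hx := Real.exp_pos (-dist (ax u) (M • ax t))
      have hk' : k⁻¹ ≤ k := (inv_le_one_of_one_le₀ hk.le).trans hk.le
      have := mul_le_mul_of_nonneg_left hk' hx.le
      linarith
    rw [Real.cosh_le_cosh, abs_of_nonneg (by linarith), abs_of_nonneg dist_nonneg] at hcosh
    exact hcosh
  · rintro ⟨K, hK, h⟩
    have hk : 1 < Real.cosh K := Real.one_lt_cosh.2 hK.ne'
    have hQ : ∀ u t, Real.cosh K * QQ M u t ≤ QQ N u t := by
      intro u t
      have h1 : Real.cosh (dist (ax u) (M • ax t) + K) ≤ Real.cosh (dist (ax u) (N • ax t)) := by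
        rw [Real.cosh_le_cosh, abs_of_nonneg (by positivity), abs_of_nonneg dist_nonneg]
        exact h u t
      rw [Real.cosh_add, cosh_ax, cosh_ax] at h1
      have h2 : 0 ≤ Real.sinh (dist (ax u) (M • ax t)) * Real.sinh K :=
        mul_nonneg (Real.sinh_nonneg_iff.2 dist_nonneg) (Real.sinh_nonneg_iff.2 hK.le)
      linarith
    have h1 := dom_corner M N _ hk hQ
    have h2 := dom_corner (JJ * M) (JJ * N) _ hk (fun u t => by
      rw [QQ_left, QQ_left]; exact hQ _ _)
    have h3 := dom_corner (M * JJ) (N * JJ) _ hk (fun u t => by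
      rw [QQ_right, QQ_right]; exact hQ _ _)
    have h4 := dom_corner (JJ * M * JJ) (JJ * N * JJ) _ hk (fun u t => by
      rw [QQ_right, QQ_right, QQ_left, QQ_left]; exact hQ _ _)
    simp only [mul10, mul11, JJ, mkSL00, mkSL10, mkSL11] at h2 h3 h4
    refine ⟨?_, ?_, h1, ?_⟩
    · convert h2 using 1 <;> ring
    · convert h4 using 1 <;> ring
    · convert h3 using 1 <;> ring

lemma meet_iff (M N : SL2) : ¬ Meet M N ↔
    ∃ K > 0, ∀ u t, dist (ax u) (M • ax t) + K ≤ dist (ax u) (N • ax t) := by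
  rw [← dominated_iff]
  exact ⟨dominated_of_not_inter M N, fun h => not_inter_of_dominated M N h.1 h.2.1 h.2.2.1 h.2.2.2⟩

lemma disjoint_iff_meet (A A' G G' : SL2) :
    Disjoint (((QuotientGroup.mk G : PSL2) * ·) '' leftCrooked (Set.range fun t => A • ax t))
      (((QuotientGroup.mk G' : PSL2) * ·) '' leftCrooked (Set.range fun t => A' • ax t)) ↔
    ¬ Meet (A⁻¹ * A') (A⁻¹ * G⁻¹ * G' * A') := by
  rw [← not_iff_not, not_not, Set.not_disjoint_iff]
  constructor
  · rintro ⟨_, ⟨h, hh, rfl⟩, ⟨h', hh', e⟩⟩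
    obtain ⟨X, rfl⟩ := QuotientGroup.mk_surjective h
    obtain ⟨X', rfl⟩ := QuotientGroup.mk_surjective h'
    rw [mem_crooked] at hh hh'
    have e2 : (QuotientGroup.mk (G' * X') : PSL2) = QuotientGroup.mk (G * X) := e
    rcases (mk_eq_iff _ _).1 e2 with e3 | e3
    · refine ⟨_, _, hh, hh', ?_⟩
      calc A⁻¹ * X * A * (A⁻¹ * A') = A⁻¹ * G⁻¹ * (G * X) * A' := by group
        _ = _ := by rw [← e3]; group
    · refine ⟨_, _, hh, C0_neg _ hh', ?_⟩
      have e4 : G * X = -(G' * X') := by rw [e3, neg_neg]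
      calc A⁻¹ * X * A * (A⁻¹ * A') = A⁻¹ * G⁻¹ * (G * X) * A' := by group
        _ = -(A⁻¹ * G⁻¹ * (G' * X') * A') := by rw [e4, mul_neg, neg_mul]
        _ = _ := by rw [mul_neg]; congr 1; group
  · rintro ⟨H, H', hH, hH', e⟩
    refine ⟨(QuotientGroup.mk (G * (A * H * A⁻¹)) : PSL2),
      ⟨QuotientGroup.mk (A * H * A⁻¹), ?_, rfl⟩, ⟨QuotientGroup.mk (A' * H' * A'⁻¹), ?_, ?_⟩⟩
    · rw [mem_crooked]; convert hH using 1; group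
    · rw [mem_crooked]; convert hH' using 1; group
    · change (QuotientGroup.mk (G' * (A' * H' * A'⁻¹)) : PSL2) = _
      congr 1
      calc G' * (A' * H' * A'⁻¹) = G * A * (A⁻¹ * G⁻¹ * G' * A' * H') * A'⁻¹ := by group
        _ = G * A * (H * (A⁻¹ * A')) * A'⁻¹ := by rw [e]
        _ = _ := by group

theorem stmt1 (l l' : Set ℍ) (hl : IsGeodesicLine l) (hl' : IsGeodesicLine l')
    (g g' : PSL2) :
    Disjoint ((g * ·) '' leftCrooked l) ((g' * ·) '' leftCrooked l') ↔
      ∃ K > 0, ∀ x ∈ l, ∀ x' ∈ l',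
        dist x x' + K ≤ dist (pslSMul g x) (pslSMul g' x') := by
  obtain ⟨γ, hγ, rfl⟩ := hl
  obtain ⟨γ', hγ', rfl⟩ := hl'
  obtain ⟨A, hA⟩ := classify γ hγ
  obtain ⟨A', hA'⟩ := classify γ' hγ'
  obtain rfl : γ = fun t => A • ax t := funext hA
  obtain rfl : γ' = fun t => A' • ax t := funext hA'
  obtain ⟨G, rfl⟩ := QuotientGroup.mk_surjective g
  obtain ⟨G', rfl⟩ := QuotientGroup.mk_surjective g'
  rw [disjoint_iff_meet, meet_iff]
  have d1 : ∀ u t, dist (A • ax u) (A' • ax t) = dist (ax u) ((A⁻¹ * A') • ax t) := by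
    intro u t
    rw [← dist_smul A (ax u), mul_smul, smul_inv_smul]
  have d2 : ∀ u t, dist (G • A • ax u) (G' • A' • ax t) =
      dist (ax u) ((A⁻¹ * G⁻¹ * G' * A') • ax t) := by
    intro u t
    rw [← dist_smul A (ax u), ← dist_smul G (A • ax u)]
    simp only [mul_smul, smul_inv_smul]
  simp only [Set.forall_mem_range, pslSMul_mk, d1, d2]

end
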